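/- arXiv:2111.00125 — 4 statements merged into one kernel-verified Lean document; each statement's English description precedes it below -/
import Mathlib

section
/- Let G be a finite simple graph of order n and size m with no isolated vertices, and let e and p be the number of end-vertices and penultimate vertices of G, respectively. Then γ×2(G) ≥ (4n − 2m + e − p)/3. -/
open scoped Classical

/-- A double dominating set: every vertex `v` satisfies `|N[v] ∩ S| ≥ 2`. -/
def IsDoubleDomSet {V : Type*} (G : SimpleGraph V) (S : Finset V) : Prop :=
  ∀ v : V, 2 ≤ ((G.neighborSet v ∪ {v}) ∩ ↑S).ncard

/-- The double domination number `γ×2(G)`: the minimum cardinality of a double dominating set. -/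
noncomputable def doubleDomNum {V : Type*} [Fintype V] (G : SimpleGraph V) : ℕ :=
  sInf {c : ℕ | ∃ S : Finset V, IsDoubleDomSet G S ∧ S.card = c}

/-- The number of end-vertices (vertices of degree `1`) of `G`. -/
noncomputable def numEnd {V : Type*} [Fintype V] (G : SimpleGraph V) [DecidableRel G.Adj] : ℕ :=
  (Finset.univ.filter fun v : V => G.degree v = 1).card

/-- The number of penultimate vertices (vertices adjacent to an end-vertex) of `G`. -/
noncomputable def numPenult {V : Type*} [Fintype V] (G : SimpleGraph V)
    [DecidableRel G.Adj] : ℕ :=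
  (Finset.univ.filter fun v : V => ∃ u : V, G.Adj v u ∧ G.degree u = 1).card

open Finset

/-- Every vertex has at least two members of a double dominating set in its closed neighborhood,
counted with the vertex itself separated from its neighbors. -/
lemma IsDoubleDomSet.two_le_card_adj_add {V : Type*} {G : SimpleGraph V}
    [DecidableRel G.Adj] {S : Finset V} (hS : IsDoubleDomSet G S) (v : V) :
    2 ≤ #{u ∈ S | G.Adj v u} + if v ∈ S then 1 else 0 := by
  have hsub : (G.neighborSet v ∪ {v}) ∩ ↑S ⊆
      (({u ∈ S | G.Adj v u} ∪ if v ∈ S then {v} else ∅ : Finset V) : Set V) := by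
    rintro x ⟨hx | rfl, hxS⟩
    · simp_all
    · have hxS : x ∈ S := hxS
      simp [hxS]
  have hcard := Set.ncard_le_ncard hsub (Finset.finite_toSet _)
  rw [Set.ncard_coe_finset] at hcard
  have hunion := card_union_le {u ∈ S | G.Adj v u} (if v ∈ S then {v} else ∅)
  have hv := hS v
  have hsingle : #(if v ∈ S then {v} else ∅) = if v ∈ S then 1 else 0 := by
    split_ifs <;> rfl
  omega

/-- An end-vertex belongs to every double dominating set. -/
lemma IsDoubleDomSet.mem_of_degree_eq_one {V : Type*} [Fintype V] {G : SimpleGraph V}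
    [DecidableRel G.Adj] {S : Finset V} (hS : IsDoubleDomSet G S) {v : V}
    (hv : G.degree v = 1) : v ∈ S := by
  by_contra h
  have h2 := hS.two_le_card_adj_add v
  have hle : #{u ∈ S | G.Adj v u} ≤ G.degree v :=
    card_le_card fun u hu => by simp_all
  simp only [h, if_false] at h2
  omega

/-- The degree sum inside a double dominating set exceeds its size by at least the number of
end-vertices minus the number of penultimate vertices. -/
lemma IsDoubleDomSet.card_add_numEnd_le {V : Type*} [Fintype V] {G : SimpleGraph V}
    [DecidableRel G.Adj] {S : Finset V} (hS : IsDoubleDomSet G S) :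
    #S + numEnd G ≤ (∑ v ∈ S, #{u ∈ S | G.Adj v u}) + numPenult G := by
  set L : Finset V := {v | G.degree v = 1} with hL
  have hleaf : #L ≤ ∑ v ∈ S, #{u ∈ L | G.Adj v u} := by
    have hswap : ∑ v ∈ S, #{u ∈ L | G.Adj v u} = ∑ u ∈ L, #{v ∈ S | G.Adj v u} :=
      sum_card_bipartiteAbove_eq_sum_card_bipartiteBelow G.Adj
    rw [hswap, card_eq_sum_ones]
    refine sum_le_sum fun u _ => ?_
    have h2 := hS.two_le_card_adj_add u
    simp only [G.adj_comm u] at h2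
    split_ifs at h2 <;> omega
  have hpen : ∑ v ∈ S, (if ∃ u, G.Adj v u ∧ G.degree u = 1 then 1 else 0) ≤ numPenult G := by
    rw [← card_filter]
    exact card_le_card fun v hv => by simp_all
  have hsum : ∑ v ∈ S, (1 + #{u ∈ L | G.Adj v u}) ≤ ∑ v ∈ S, (#{u ∈ S | G.Adj v u} +
      if ∃ u, G.Adj v u ∧ G.degree u = 1 then 1 else 0) := by
    refine sum_le_sum fun v hv => ?_
    split_ifs with h
    · have : #{u ∈ L | G.Adj v u} ≤ #{u ∈ S | G.Adj v u} := by
        refine card_le_card fun u hu => ?_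
        simp only [hL, mem_filter, mem_univ, true_and] at hu ⊢
        exact ⟨hS.mem_of_degree_eq_one hu.1, hu.2⟩
      omega
    · have hempty : {u ∈ L | G.Adj v u} = ∅ :=
        filter_eq_empty_iff.mpr fun u hu huv => h ⟨u, huv, by simpa [hL] using hu⟩
      have h2 := hS.two_le_card_adj_add v
      rw [if_pos hv] at h2
      rw [hempty, card_empty]
      omega
  rw [sum_add_distrib, sum_add_distrib, ← card_eq_sum_ones] at hsum
  have he : numEnd G = #L := rfl
  omega

/-- The size bound satisfied by every double dominating set. -/
lemma IsDoubleDomSet.four_mul_card_add_numEnd_le {V : Type*} [Fintype V] {G : SimpleGraph V}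
    [DecidableRel G.Adj] {S : Finset V} (hS : IsDoubleDomSet G S) :
    4 * Fintype.card V + numEnd G ≤ 3 * #S + 2 * #G.edgeFinset + numPenult G := by
  have hdeg (v : V) : G.degree v = #{u ∈ S | G.Adj v u} + #{u ∈ Sᶜ | G.Adj v u} := by
    rw [← card_union_of_disjoint (disjoint_filter_filter disjoint_compl_right),
      ← filter_union, union_compl, ← G.card_neighborFinset_eq_degree, G.neighborFinset_eq_filter]
  have hsplit : (∑ v ∈ S, G.degree v) + ∑ v ∈ Sᶜ, G.degree v = 2 * #G.edgeFinset := by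
    rw [sum_add_sum_compl, G.sum_degrees_eq_twice_card_edges]
  have hswap : ∑ v ∈ S, #{u ∈ Sᶜ | G.Adj v u} = ∑ v ∈ Sᶜ, #{u ∈ S | G.Adj v u} := by
    have h : ∑ v ∈ S, #{u ∈ Sᶜ | G.Adj v u} = ∑ u ∈ Sᶜ, #{v ∈ S | G.Adj v u} :=
      sum_card_bipartiteAbove_eq_sum_card_bipartiteBelow G.Adj
    simpa only [G.adj_comm] using h
  have hout : #Sᶜ * 2 ≤ ∑ v ∈ Sᶜ, #{u ∈ S | G.Adj v u} := by
    rw [← smul_eq_mul]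
    refine card_nsmul_le_sum _ _ _ fun v hv => ?_
    simpa [mem_compl.mp hv] using hS.two_le_card_adj_add v
  have hcompl := card_add_card_compl S
  have hin := hS.card_add_numEnd_le
  simp only [hdeg, sum_add_distrib] at hsplit
  omega

/-- In a graph without isolated vertices the whole vertex set is double dominating. -/
lemma isDoubleDomSet_univ {V : Type*} [Fintype V] (G : SimpleGraph V) [DecidableRel G.Adj]
    (hδ : ∀ v : V, 1 ≤ G.degree v) : IsDoubleDomSet G univ := by
  intro v
  obtain ⟨u, hu⟩ := (G.degree_pos_iff_exists_adj v).mp (hδ v)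
  rw [← Set.ncard_pair hu.ne]
  refine Set.ncard_le_ncard ?_ (Set.toFinite _)
  rintro x (rfl | rfl) <;> simp [hu]

/-- for a graph `G` of order `n` and size `m` with no isolated vertices,
`e` end-vertices and `p` penultimate vertices, `γ×2(G) ≥ (4n − 2m + e − p)/3`. -/
theorem doubleDomNum_lower_bound {V : Type*} [Fintype V] (G : SimpleGraph V)
    [DecidableRel G.Adj] (n m e p : ℕ) (hn : Fintype.card V = n)
    (hm : G.edgeFinset.card = m) (he : numEnd G = e) (hp : numPenult G = p)
    (hδ : ∀ v : V, 1 ≤ G.degree v) :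
    (4 * (n : ℚ) - 2 * (m : ℚ) + (e : ℚ) - (p : ℚ)) / 3 ≤ (doubleDomNum G : ℚ) := by
  obtain ⟨S, hS, hcard⟩ :
      doubleDomNum G ∈ {c : ℕ | ∃ S : Finset V, IsDoubleDomSet G S ∧ S.card = c} :=
    Nat.sInf_mem ⟨_, univ, isDoubleDomSet_univ G hδ, rfl⟩
  have h := hS.four_mul_card_add_numEnd_le
  rw [hn, hm, he, hp, hcard] at h
  have hq : 4 * (n : ℚ) + e ≤ 3 * doubleDomNum G + 2 * m + p := by exact_mod_cast h
  linarith
end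

section
/- If T is a nontrivial tree (a connected acyclic graph with at least 2 vertices) of order n with ℓ leaves and s support vertices, then γ×2(T) ≥ (2n + ℓ − s + 2)/3. -/
open scoped Classical

section DoubleDomination

variable {V : Type*} [Fintype V] {G : SimpleGraph V} [DecidableRel G.Adj] {S : Finset V}

theorem isDoubleDomSet_iff_card :
    IsDoubleDomSet G S ↔
      ∀ v, 2 ≤ (G.neighborFinset v ∩ S).card + if v ∈ S then 1 else 0 := by
  refine forall_congr' fun v => ?_
  have h : (G.neighborSet v ∪ {v}) ∩ (S : Set V)
      = ((G.neighborFinset v ∩ S ∪ if v ∈ S then {v} else ∅ : Finset V) : Set V) := by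
    ext u
    by_cases hv : v ∈ S <;> by_cases hu : u = v <;> simp_all
  have hd : Disjoint (G.neighborFinset v ∩ S) (if v ∈ S then {v} else ∅ : Finset V) := by
    split_ifs <;> simp
  rw [h, Set.ncard_coe_finset, Finset.card_union_of_disjoint hd]
  split_ifs <;> simp

namespace IsDoubleDomSet

theorem two_le_card_inter (h : IsDoubleDomSet G S) {v : V} (hv : v ∉ S) :
    2 ≤ (G.neighborFinset v ∩ S).card := by
  simpa [hv] using isDoubleDomSet_iff_card.1 h v

theorem one_le_card_inter (h : IsDoubleDomSet G S) (v : V) :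
    1 ≤ (G.neighborFinset v ∩ S).card := by
  have := isDoubleDomSet_iff_card.1 h v
  split_ifs at this <;> omega

theorem mem_of_degree_eq_one_s11 (h : IsDoubleDomSet G S) {u : V} (hu : G.degree u = 1) :
    u ∈ S := by
  by_contra hS
  have h1 := h.two_le_card_inter hS
  have h2 := Finset.card_le_card (Finset.inter_subset_left : G.neighborFinset u ∩ S ⊆ _)
  rw [G.card_neighborFinset_eq_degree] at h2
  omega

theorem mem_of_adj_degree_eq_one (h : IsDoubleDomSet G S) {u v : V} (huv : G.Adj v u)
    (hu : G.degree u = 1) : v ∈ S := by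
  have h1 := h.one_le_card_inter u
  have h2 : G.neighborFinset u ∩ S = G.neighborFinset u :=
    Finset.eq_of_subset_of_card_le Finset.inter_subset_left
      (by rw [G.card_neighborFinset_eq_degree]; omega)
  exact Finset.inter_eq_left.1 h2 (by simpa using huv.symm)

end IsDoubleDomSet

theorem sum_card_neighborFinset_inter_comm (A B : Finset V) :
    ∑ v ∈ A, (G.neighborFinset v ∩ B).card = ∑ v ∈ B, (G.neighborFinset v ∩ A).card := by
  have h := Finset.sum_card_bipartiteAbove_eq_sum_card_bipartiteBelow (s := A) (t := B) G.Adj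
  convert h using 3 with v _ v _
  · ext u; simp [Finset.bipartiteAbove, and_comm]
  · ext u; simp [Finset.bipartiteBelow, and_comm, G.adj_comm]

theorem sum_card_end_neighbors :
    ∑ v, (G.neighborFinset v ∩ ({u | G.degree u = 1} : Finset V)).card = numEnd G := by
  rw [sum_card_neighborFinset_inter_comm, numEnd, Finset.card_eq_sum_ones]
  refine Finset.sum_congr rfl fun u hu => ?_
  simpa using hu

theorem IsDoubleDomSet.card_add_numEnd_le_s11 (h : IsDoubleDomSet G S) :
    S.card + numEnd G ≤ ∑ v ∈ S, (G.neighborFinset v ∩ S).card + numPenult G := by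
  have hend : ∑ v ∈ S, (G.neighborFinset v ∩ ({u | G.degree u = 1} : Finset V)).card = numEnd G := by
    rw [← sum_card_end_neighbors]
    refine Finset.sum_subset (Finset.subset_univ S) fun v _ hv => ?_
    rw [Finset.card_eq_zero, Finset.eq_empty_iff_forall_notMem]
    intro u hu
    simp only [Finset.mem_inter, SimpleGraph.mem_neighborFinset, Finset.mem_filter,
      Finset.mem_univ, true_and] at hu
    exact hv (h.mem_of_adj_degree_eq_one hu.1 hu.2)
  have hpen : ∑ v ∈ S, (if ∃ u, G.Adj v u ∧ G.degree u = 1 then 1 else 0) ≤ numPenult G := by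
    rw [numPenult, Finset.card_filter]
    exact Finset.sum_le_sum_of_subset (Finset.subset_univ S)
  rw [← hend, Finset.card_eq_sum_ones, ← Finset.sum_add_distrib]
  refine le_trans ?_ (Nat.add_le_add_left hpen _)
  rw [← Finset.sum_add_distrib]
  refine Finset.sum_le_sum fun v _ => ?_
  split_ifs with hv
  · have hsub : ({u | G.degree u = 1} : Finset V) ⊆ S := fun u hu =>
      h.mem_of_degree_eq_one_s11 (by simpa using hu)
    have := Finset.card_le_card
      (Finset.inter_subset_inter (Finset.Subset.refl (G.neighborFinset v)) hsub)
    omega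
  · have hempty : G.neighborFinset v ∩ ({u | G.degree u = 1} : Finset V) = ∅ := by
      rw [Finset.eq_empty_iff_forall_notMem]
      intro u hu
      exact hv ⟨u, by simpa using hu⟩
    simpa [hempty] using h.one_le_card_inter v

theorem sum_degrees_eq_sum_inter (S : Finset V) :
    ∑ v, G.degree v = ∑ v ∈ S, (G.neighborFinset v ∩ S).card
      + 2 * ∑ v ∈ Sᶜ, (G.neighborFinset v ∩ S).card
      + ∑ v ∈ Sᶜ, (G.neighborFinset v ∩ Sᶜ).card := by
  have hdeg (v : V) : G.degree v
      = (G.neighborFinset v ∩ S).card + (G.neighborFinset v ∩ Sᶜ).card := by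
    rw [← Finset.sdiff_eq_inter_compl, Finset.card_inter_add_card_sdiff,
      G.card_neighborFinset_eq_degree]
  rw [← Finset.sum_add_sum_compl S, Finset.sum_congr rfl fun v _ => hdeg v,
    Finset.sum_congr (s₁ := Sᶜ) rfl fun v _ => hdeg v, Finset.sum_add_distrib,
    Finset.sum_add_distrib, sum_card_neighborFinset_inter_comm S Sᶜ]
  ring

theorem IsDoubleDomSet.card_bound_of_isTree (h : IsDoubleDomSet G S) (hG : G.IsTree) :
    2 * Fintype.card V + numEnd G + 2 ≤ 3 * S.card + numPenult G := by
  have hedge : G.edgeFinset.card + 1 = Fintype.card V := hG.card_edgeFinset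
  have hsum := G.sum_degrees_eq_twice_card_edges
  have hsplit := sum_degrees_eq_sum_inter (G := G) S
  have hin := h.card_add_numEnd_le_s11
  have hout : Sᶜ.card * 2 ≤ ∑ v ∈ Sᶜ, (G.neighborFinset v ∩ S).card :=
    Finset.card_nsmul_le_sum _ _ _ fun v hv =>
      h.two_le_card_inter (Finset.mem_compl.1 hv)
  have hcompl := S.card_add_card_compl
  omega

theorem isDoubleDomSet_univ_s11 [Nontrivial V] (hG : G.Connected) :
    IsDoubleDomSet G Finset.univ := by
  rw [isDoubleDomSet_iff_card]
  intro v
  have := hG.preconnected.degree_pos_of_nontrivial v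
  simp only [Finset.inter_univ, SimpleGraph.card_neighborFinset_eq_degree, Finset.mem_univ,
    if_true]
  omega

end DoubleDomination

/-- if `T` is a nontrivial tree of order `n` with `ℓ` leaves and
`s` support vertices, then `γ×2(T) ≥ (2n + ℓ − s + 2)/3`. -/
theorem doubleDomNum_tree_lower_bound {V : Type*} [Fintype V] (T : SimpleGraph V)
    [DecidableRel T.Adj] (hT : T.IsTree) (n l s : ℕ) (hn : Fintype.card V = n)
    (hn2 : 2 ≤ n) (hl : numEnd T = l) (hs : numPenult T = s) :
    (2 * (n : ℚ) + (l : ℚ) - (s : ℚ) + 2) / 3 ≤ (doubleDomNum T : ℚ) := by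
  have : Nontrivial V := Fintype.one_lt_card_iff_nontrivial.1 (by omega)
  obtain ⟨S, hS, hcard⟩ : doubleDomNum T ∈
      {c : ℕ | ∃ S : Finset V, IsDoubleDomSet T S ∧ S.card = c} :=
    Nat.sInf_mem ⟨_, Finset.univ, isDoubleDomSet_univ_s11 hT.connected, rfl⟩
  have h := hS.card_bound_of_isTree hT
  rw [hcard, hn, hl, hs] at h
  have hq : 2 * (n : ℚ) + l + 2 ≤ 3 * doubleDomNum T + s := by exact_mod_cast h
  linarith
end

section
/- Let k ≥ 1 be an integer and let G be a finite simple graph of order n and size m with minimum degree δ(G) ≥ k − 1. Then k · γ×k(G) · d×k(G) · (d×k(G) − 1) ≤ 2(2m − (k−1)n)/2 · 2, more precisely: k · γ×k(G) · d×k(G) · (d×k(G) − 1) ≤ 2m − (k−1)n; equivalently, d×k(G) ≤ 1/2 + √(1/4 + (2m − (k−1)n)/(k·γ×k(G))). -/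
open scoped Classical

/-- A `k`-tuple dominating set: every vertex `v` satisfies `|N[v] ∩ S| ≥ k`. -/
def IsKTupleDomSet {V : Type*} (G : SimpleGraph V) (k : ℕ) (S : Finset V) : Prop :=
  ∀ v : V, k ≤ ((G.neighborSet v ∪ {v}) ∩ ↑S).ncard

/-- The `k`-tuple domination number `γ×k(G)`:
the minimum cardinality of a `k`-tuple dominating set. -/
noncomputable def kTupleDomNum {V : Type*} [Fintype V] (G : SimpleGraph V) (k : ℕ) : ℕ :=
  sInf {c : ℕ | ∃ S : Finset V, IsKTupleDomSet G k S ∧ S.card = c}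

/-- The `k`-tuple domatic number `d×k(G)`: the maximum number of parts in a partition of
`V(G)` all of whose parts are `k`-tuple dominating sets. -/
noncomputable def kDomaticNum {V : Type*} [Fintype V] (G : SimpleGraph V) (k : ℕ) : ℕ :=
  sSup {r : ℕ | ∃ P : Finset (Finset V), P.card = r ∧
    (∀ v : V, ∃! S, S ∈ P ∧ v ∈ S) ∧ ∀ S ∈ P, IsKTupleDomSet G k S}

theorem sum_card_inter_of_existsUnique {V : Type*} {P : Finset (Finset V)}
    (hP : ∀ v : V, ∃! S, S ∈ P ∧ v ∈ S) (A : Finset V) :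
    ∑ S ∈ P, (A ∩ S).card = A.card := by
  rw [← Finset.card_biUnion]
  · congr 1
    ext v
    obtain ⟨S, hS, -⟩ := hP v
    simp only [Finset.mem_biUnion, Finset.mem_inter]
    exact ⟨fun ⟨_, _, hv, _⟩ => hv, fun hv => ⟨S, hS.1, hv, hS.2⟩⟩
  · intro S hS T hT hST
    refine Finset.disjoint_left.2 fun v hvS hvT => hST ?_
    exact (hP v).unique ⟨hS, (Finset.mem_inter.1 hvS).2⟩ ⟨hT, (Finset.mem_inter.1 hvT).2⟩

theorem isKTupleDomSet_iff {V : Type*} [Fintype V] (G : SimpleGraph V) [DecidableRel G.Adj]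
    (k : ℕ) (S : Finset V) :
    IsKTupleDomSet G k S ↔ ∀ v, k ≤ (insert v (G.neighborFinset v) ∩ S).card := by
  refine forall_congr' fun v => ?_
  rw [← Set.ncard_coe_finset]
  simp [Set.union_singleton]

theorem card_insert_neighborFinset {V : Type*} [Fintype V] (G : SimpleGraph V)
    [DecidableRel G.Adj] (v : V) :
    (insert v (G.neighborFinset v)).card = G.degree v + 1 := by
  rw [Finset.card_insert_of_notMem (by simp), G.card_neighborFinset_eq_degree]

theorem IsKTupleDomSet.kTupleDomNum_le {V : Type*} [Fintype V] {G : SimpleGraph V} {k : ℕ}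
    {S : Finset V} (hS : IsKTupleDomSet G k S) : kTupleDomNum G k ≤ S.card :=
  Nat.sInf_le ⟨S, hS, rfl⟩

theorem isKTupleDomSet_univ {V : Type*} [Fintype V] {G : SimpleGraph V} [DecidableRel G.Adj]
    {k : ℕ} (hδ : ∀ v : V, k - 1 ≤ G.degree v) : IsKTupleDomSet G k Finset.univ := by
  rw [isKTupleDomSet_iff]
  intro v
  rw [Finset.inter_univ, card_insert_neighborFinset]
  have := hδ v
  omega

theorem kTupleDomNum_pos {V : Type*} [Fintype V] [Nonempty V] {G : SimpleGraph V}
    [DecidableRel G.Adj] {k : ℕ} (hk : 1 ≤ k) (hδ : ∀ v : V, k - 1 ≤ G.degree v) :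
    0 < kTupleDomNum G k := by
  obtain ⟨S, hS, hc⟩ : kTupleDomNum G k ∈
      {c : ℕ | ∃ S : Finset V, IsKTupleDomSet G k S ∧ S.card = c} :=
    Nat.sInf_mem ⟨_, _, isKTupleDomSet_univ hδ, rfl⟩
  rw [← hc]
  obtain ⟨v⟩ := ‹Nonempty V›
  exact (hk.trans ((isKTupleDomSet_iff G k S).1 hS v)).trans
    (Finset.card_le_card Finset.inter_subset_right)

theorem bddAbove_kDomatic {V : Type*} [Fintype V] (G : SimpleGraph V) (k : ℕ) :
    BddAbove {r : ℕ | ∃ P : Finset (Finset V), P.card = r ∧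
      (∀ v : V, ∃! S, S ∈ P ∧ v ∈ S) ∧ ∀ S ∈ P, IsKTupleDomSet G k S} := by
  refine ⟨Fintype.card (Finset V), ?_⟩
  rintro _ ⟨P, rfl, -⟩
  exact P.card_le_univ

theorem one_mem_kDomatic {V : Type*} [Fintype V] {G : SimpleGraph V} [DecidableRel G.Adj]
    {k : ℕ} (hδ : ∀ v : V, k - 1 ≤ G.degree v) :
    1 ∈ {r : ℕ | ∃ P : Finset (Finset V), P.card = r ∧
      (∀ v : V, ∃! S, S ∈ P ∧ v ∈ S) ∧ ∀ S ∈ P, IsKTupleDomSet G k S} := by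
  refine ⟨{Finset.univ}, by simp, fun v => ⟨Finset.univ, by simp, ?_⟩, ?_⟩
  · rintro S ⟨hS, -⟩
    exact Finset.mem_singleton.1 hS
  · intro S hS
    rw [Finset.mem_singleton.1 hS]
    exact isKTupleDomSet_univ hδ

theorem one_le_kDomaticNum {V : Type*} [Fintype V] {G : SimpleGraph V} [DecidableRel G.Adj]
    {k : ℕ} (hδ : ∀ v : V, k - 1 ≤ G.degree v) : 1 ≤ kDomaticNum G k :=
  le_csSup (bddAbove_kDomatic G k) (one_mem_kDomatic hδ)

theorem exists_kDomatic_partition {V : Type*} [Fintype V] {G : SimpleGraph V}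
    [DecidableRel G.Adj] {k : ℕ} (hδ : ∀ v : V, k - 1 ≤ G.degree v) :
    ∃ P : Finset (Finset V), P.card = kDomaticNum G k ∧
      (∀ v : V, ∃! S, S ∈ P ∧ v ∈ S) ∧ ∀ S ∈ P, IsKTupleDomSet G k S :=
  Nat.sSup_mem ⟨1, one_mem_kDomatic hδ⟩ (bddAbove_kDomatic G k)

theorem kDomaticNum_mul_kTupleDomNum_le_card {V : Type*} [Fintype V] {G : SimpleGraph V}
    [DecidableRel G.Adj] {k : ℕ} (hδ : ∀ v : V, k - 1 ≤ G.degree v) :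
    kDomaticNum G k * kTupleDomNum G k ≤ Fintype.card V := by
  obtain ⟨P, hc, hP, hD⟩ := exists_kDomatic_partition hδ
  rw [← hc, ← Finset.card_univ, ← sum_card_inter_of_existsUnique hP]
  refine Finset.card_nsmul_le_sum P _ _ fun S hS => ?_
  rw [Finset.univ_inter]
  exact (hD S hS).kTupleDomNum_le

theorem kDomaticNum_mul_le_degree_add_one {V : Type*} [Fintype V] {G : SimpleGraph V}
    [DecidableRel G.Adj] {k : ℕ} (hδ : ∀ v : V, k - 1 ≤ G.degree v) (v : V) :
    kDomaticNum G k * k ≤ G.degree v + 1 := by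
  obtain ⟨P, hc, hP, hD⟩ := exists_kDomatic_partition hδ
  rw [← hc, ← card_insert_neighborFinset, ← sum_card_inter_of_existsUnique hP]
  exact Finset.card_nsmul_le_sum P _ _ fun S hS => (isKTupleDomSet_iff G k S).1 (hD S hS) v

theorem card_mul_kDomaticNum_mul_le {V : Type*} [Fintype V] {G : SimpleGraph V}
    [DecidableRel G.Adj] {k : ℕ} (hδ : ∀ v : V, k - 1 ≤ G.degree v) :
    Fintype.card V * (kDomaticNum G k * k) ≤ 2 * G.edgeFinset.card + Fintype.card V := by
  calc Fintype.card V * (kDomaticNum G k * k)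
      ≤ ∑ v : V, (G.degree v + 1) :=
        Finset.card_nsmul_le_sum _ _ _ fun v _ => kDomaticNum_mul_le_degree_add_one hδ v
    _ = 2 * G.edgeFinset.card + Fintype.card V := by
        rw [Finset.sum_add_distrib, G.sum_degrees_eq_twice_card_edges]
        simp

theorem kDomaticNum_le_one_of_isEmpty {V : Type*} [Fintype V] [IsEmpty V] {G : SimpleGraph V}
    [DecidableRel G.Adj] {k : ℕ} (hδ : ∀ v : V, k - 1 ≤ G.degree v) :
    kDomaticNum G k ≤ 1 := by
  obtain ⟨P, hc, -⟩ := exists_kDomatic_partition hδ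
  rw [← hc]
  exact Finset.card_le_one_of_subsingleton P

/-- if `k ≥ 1` and `G` has order `n`, size `m` and minimum degree at least
`k − 1`, then `k·γ×k(G)·d×k(G)·(d×k(G) − 1) ≤ 2m − (k−1)n`; equivalently,
`d×k(G) ≤ 1/2 + √(1/4 + (2m − (k−1)n)/(k·γ×k(G)))`. -/
theorem kDomaticNum_upper_bound {V : Type*} [Fintype V] (G : SimpleGraph V)
    [DecidableRel G.Adj] (k n m : ℕ) (hk : 1 ≤ k) (hn : Fintype.card V = n)
    (hm : G.edgeFinset.card = m) (hδ : ∀ v : V, k - 1 ≤ G.degree v) :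
    (k : ℤ) * kTupleDomNum G k * kDomaticNum G k * ((kDomaticNum G k : ℤ) - 1) ≤
      2 * (m : ℤ) - ((k : ℤ) - 1) * (n : ℤ) ∧
    (kDomaticNum G k : ℝ) ≤ 1 / 2 + Real.sqrt (1 / 4 +
      (2 * (m : ℝ) - ((k : ℝ) - 1) * (n : ℝ)) / ((k : ℝ) * (kTupleDomNum G k : ℝ))) := by
  have hmain : (k : ℤ) * kTupleDomNum G k * kDomaticNum G k * ((kDomaticNum G k : ℤ) - 1) ≤
      2 * (m : ℤ) - ((k : ℤ) - 1) * (n : ℤ) := by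
    have h1 : (kDomaticNum G k : ℤ) * kTupleDomNum G k ≤ n := by
      rw [← hn]
      exact_mod_cast kDomaticNum_mul_kTupleDomNum_le_card hδ
    have h2 : (n : ℤ) * (kDomaticNum G k * k) ≤ 2 * m + n := by
      rw [← hn, ← hm]
      exact_mod_cast card_mul_kDomaticNum_mul_le hδ
    have h3 : (0 : ℤ) ≤ k * ((kDomaticNum G k : ℤ) - 1) := by
      have : (1 : ℤ) ≤ kDomaticNum G k := by exact_mod_cast one_le_kDomaticNum hδ
      exact mul_nonneg (by positivity) (by linarith)
    linarith [mul_le_mul_of_nonneg_right h1 h3]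
  refine ⟨hmain, ?_⟩
  rw [← sub_le_iff_le_add']
  apply Real.le_sqrt_of_sq_le
  rcases isEmpty_or_nonempty V with hV | hV
  · have hd : kDomaticNum G k = 1 :=
      le_antisymm (kDomaticNum_le_one_of_isEmpty hδ) (one_le_kDomaticNum hδ)
    have hn0 : n = 0 := by rw [← hn, Fintype.card_eq_zero]
    have : (0 : ℝ) ≤ (2 * (m : ℝ) - ((k : ℝ) - 1) * (n : ℝ)) / (k * kTupleDomNum G k) := by
      rw [hn0, Nat.cast_zero, mul_zero, sub_zero]
      positivity
    rw [hd]
    norm_num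
    linarith
  · have hγ : (0 : ℝ) < kTupleDomNum G k := by exact_mod_cast kTupleDomNum_pos hk hδ
    have hk0 : (0 : ℝ) < k := by exact_mod_cast hk
    have hreal : (k : ℝ) * kTupleDomNum G k * kDomaticNum G k * ((kDomaticNum G k : ℝ) - 1) ≤
        2 * (m : ℝ) - ((k : ℝ) - 1) * (n : ℝ) := by exact_mod_cast hmain
    have hdiv : (kDomaticNum G k : ℝ) * ((kDomaticNum G k : ℝ) - 1) ≤
        (2 * (m : ℝ) - ((k : ℝ) - 1) * (n : ℝ)) / (k * kTupleDomNum G k) := by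
      rw [le_div_iff₀ (mul_pos hk0 hγ)]
      linarith
    linarith
end

section
/- Let G be a finite simple graph of size m. Then γ(G) · d(G) · (d(G) − 1) ≤ 2m; equivalently, the domatic number satisfies d(G) ≤ 1/2 + √(1/4 + 2m/γ(G)). -/
open scoped Classical

/-- A dominating set: every vertex not in `S` has at least one neighbor in `S`. -/
def IsDomSet {V : Type*} (G : SimpleGraph V) (S : Finset V) : Prop :=
  ∀ v : V, v ∉ S → ∃ u ∈ S, G.Adj v u

/-- The domination number `γ(G)`: the minimum cardinality of a dominating set. -/
noncomputable def domNum {V : Type*} [Fintype V] (G : SimpleGraph V) : ℕ :=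
  sInf {c : ℕ | ∃ S : Finset V, IsDomSet G S ∧ S.card = c}

/-- The domatic number `d(G)`: the maximum number of parts in a partition of `V(G)` all of
whose parts are dominating sets. -/
noncomputable def domaticNum {V : Type*} [Fintype V] (G : SimpleGraph V) : ℕ :=
  sSup {r : ℕ | ∃ P : Finset (Finset V), P.card = r ∧
    (∀ v : V, ∃! S, S ∈ P ∧ v ∈ S) ∧ ∀ S ∈ P, IsDomSet G S}

theorem domNum_le_card {V : Type*} [Fintype V] {G : SimpleGraph V} {S : Finset V}
    (hS : IsDomSet G S) : domNum G ≤ S.card :=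
  Nat.sInf_le ⟨S, hS, rfl⟩

theorem exists_isDomSet_card_eq_domNum {V : Type*} [Fintype V] (G : SimpleGraph V) :
    ∃ S : Finset V, IsDomSet G S ∧ S.card = domNum G :=
  Nat.sInf_mem (s := {c : ℕ | ∃ S : Finset V, IsDomSet G S ∧ S.card = c})
    ⟨_, Finset.univ, fun v hv => absurd (Finset.mem_univ v) hv, rfl⟩

theorem isEmpty_of_domNum_eq_zero {V : Type*} [Fintype V] {G : SimpleGraph V}
    (h : domNum G = 0) : IsEmpty V := by
  obtain ⟨S, hS, hc⟩ := exists_isDomSet_card_eq_domNum G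
  rw [h, Finset.card_eq_zero] at hc
  subst hc
  refine ⟨fun v => ?_⟩
  obtain ⟨u, hu, -⟩ := hS v (Finset.notMem_empty v)
  exact Finset.notMem_empty u hu

theorem exists_domatic_partition {V : Type*} [Fintype V] (G : SimpleGraph V) :
    ∃ P : Finset (Finset V), P.card = domaticNum G ∧
      (∀ v : V, ∃! S, S ∈ P ∧ v ∈ S) ∧ ∀ S ∈ P, IsDomSet G S := by
  refine Nat.sSup_mem (s := {r : ℕ | ∃ P : Finset (Finset V), P.card = r ∧
    (∀ v : V, ∃! S, S ∈ P ∧ v ∈ S) ∧ ∀ S ∈ P, IsDomSet G S}) ?_ ?_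
  · refine ⟨_, {Finset.univ}, rfl, fun v => ⟨Finset.univ, by simp, ?_⟩, ?_⟩
    · rintro S ⟨hS, -⟩
      exact Finset.mem_singleton.mp hS
    · intro S hS v hv
      rw [Finset.mem_singleton.mp hS] at hv
      exact absurd (Finset.mem_univ v) hv
  · refine ⟨Fintype.card (Finset V), ?_⟩
    rintro r ⟨P, rfl, -⟩
    exact Finset.card_le_univ P

theorem card_filter_mem_eq_one {V : Type*} {P : Finset (Finset V)} {v : V}
    (h : ∃! S, S ∈ P ∧ v ∈ S) : (P.filter (v ∈ ·)).card = 1 := by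
  obtain ⟨S, hS, huniq⟩ := h
  refine Finset.card_eq_one.mpr ⟨S, ?_⟩
  ext T
  rw [Finset.mem_filter, Finset.mem_singleton]
  exact ⟨huniq T, fun hT => hT ▸ hS⟩

theorem card_sub_one_le_degree {V : Type*} [Fintype V] (G : SimpleGraph V)
    [DecidableRel G.Adj] {P : Finset (Finset V)} (hpart : ∀ v : V, ∃! S, S ∈ P ∧ v ∈ S)
    (hdom : ∀ S ∈ P, IsDomSet G S) (v : V) : P.card - 1 ≤ G.degree v := by
  have hsplit := Finset.card_filter_add_card_filter_not (s := P) (v ∈ ·)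
  rw [card_filter_mem_eq_one (hpart v)] at hsplit
  have hnbr : ∀ S : Finset V, ∃ u, S ∈ P.filter (v ∉ ·) → u ∈ S ∧ G.Adj v u := by
    intro S
    by_cases hS : S ∈ P.filter (v ∉ ·)
    · obtain ⟨hSP, hvS⟩ := Finset.mem_filter.mp hS
      obtain ⟨u, hu⟩ := hdom S hSP v hvS
      exact ⟨u, fun _ => hu⟩
    · exact ⟨v, fun h => absurd h hS⟩
  choose f hf using hnbr
  have hle : (P.filter (v ∉ ·)).card ≤ (G.neighborFinset v).card := by
    refine Finset.card_le_card_of_injOn f (fun S hS => ?_) (fun S hS T hT hST => ?_)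
    · exact (G.mem_neighborFinset v _).mpr (hf S hS).2
    · refine (hpart (f S)).unique ⟨(Finset.mem_filter.mp hS).1, (hf S hS).1⟩
        ⟨(Finset.mem_filter.mp hT).1, ?_⟩
      rw [hST]
      exact (hf T hT).1
  rw [G.card_neighborFinset_eq_degree] at hle
  omega

theorem domNum_mul_domaticNum_le_card {V : Type*} [Fintype V] (G : SimpleGraph V) :
    domNum G * domaticNum G ≤ Fintype.card V := by
  obtain ⟨P, hcard, hpart, hdom⟩ := exists_domatic_partition G
  have hsum : ∑ S ∈ P, S.card = Fintype.card V * 1 :=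
    Finset.sum_card fun v => card_filter_mem_eq_one (hpart v)
  have hle := Finset.card_nsmul_le_sum P Finset.card (domNum G)
    fun S hS => domNum_le_card (hdom S hS)
  rw [hsum, hcard, smul_eq_mul, mul_one, mul_comm] at hle
  exact hle

theorem domNum_mul_domaticNum_mul_le {V : Type*} [Fintype V] (G : SimpleGraph V)
    [DecidableRel G.Adj] :
    domNum G * domaticNum G * (domaticNum G - 1) ≤ 2 * G.edgeFinset.card := by
  obtain ⟨P, hcard, hpart, hdom⟩ := exists_domatic_partition G
  have hdeg := Finset.card_nsmul_le_sum Finset.univ (fun v => G.degree v) (domaticNum G - 1)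
    fun v _ => hcard ▸ card_sub_one_le_degree G hpart hdom v
  rw [G.sum_degrees_eq_twice_card_edges, smul_eq_mul, Finset.card_univ] at hdeg
  exact (Nat.mul_le_mul_right _ (domNum_mul_domaticNum_le_card G)).trans hdeg

theorem domaticNum_le_one_of_isEmpty {V : Type*} [Fintype V] [IsEmpty V]
    (G : SimpleGraph V) : domaticNum G ≤ 1 := by
  obtain ⟨P, hcard, -⟩ := exists_domatic_partition G
  rw [← hcard]
  exact Finset.card_le_one_of_subsingleton P

/-- for a graph `G` of size `m`, `γ(G)·d(G)·(d(G) − 1) ≤ 2m`; equivalently,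
`d(G) ≤ 1/2 + √(1/4 + 2m/γ(G))`. -/
theorem domaticNum_upper_bound {V : Type*} [Fintype V] (G : SimpleGraph V)
    [DecidableRel G.Adj] (m : ℕ) (hm : G.edgeFinset.card = m) :
    domNum G * domaticNum G * (domaticNum G - 1) ≤ 2 * m ∧
    (domaticNum G : ℝ) ≤ 1 / 2 +
      Real.sqrt (1 / 4 + 2 * (m : ℝ) / (domNum G : ℝ)) := by
  subst hm
  have hmain := domNum_mul_domaticNum_mul_le G
  refine ⟨hmain, ?_⟩
  rw [← sub_le_iff_le_add']
  apply Real.le_sqrt_of_sq_le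
  have hquot : (0 : ℝ) ≤ 2 * (G.edgeFinset.card : ℝ) / (domNum G : ℝ) := by positivity
  suffices h : (domaticNum G : ℝ) * (domaticNum G - 1) ≤
      2 * (G.edgeFinset.card : ℝ) / (domNum G : ℝ) by
    nlinarith
  rcases Nat.lt_or_ge 1 (domaticNum G) with hd | hd
  · have hpos : 0 < domNum G := by
      refine Nat.pos_of_ne_zero fun h => ?_
      have := isEmpty_of_domNum_eq_zero h
      exact absurd (domaticNum_le_one_of_isEmpty G) hd.not_ge
    rw [le_div_iff₀ (Nat.cast_pos.mpr hpos)]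
    have hreal : (domNum G : ℝ) * domaticNum G * ((domaticNum G - 1 : ℕ) : ℝ) ≤
        2 * G.edgeFinset.card := by
      exact_mod_cast hmain
    rw [Nat.cast_sub hd.le, Nat.cast_one] at hreal
    linarith
  · have hd' : (domaticNum G : ℝ) ≤ 1 := by exact_mod_cast hd
    exact (mul_nonpos_of_nonneg_of_nonpos (Nat.cast_nonneg _) (by linarith)).trans hquot
end
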